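/- arXiv:1907.10050 — 2 statements merged into one kernel-verified Lean document; each statement's English description precedes it below -/
import Mathlib

section
/- Let X be a centered self-decomposable random vector in ℝ^d with Lévy measure ν such that ∫_{‖u‖≥1} ‖u‖ ν(du) < ∞ and ν(du) = 1_{(0,∞)}(r) 1_{S^{d−1}}(x) (k_x(r)/r) dr σ(dx), where σ is a finite positive measure on S^{d−1} and k_x(r) ≥ 0 is a continuous function, nonincreasing in r ∈ (0,∞), continuous in x ∈ S^{d−1}, with lim_{r→∞} k_x(r) = 0 and lim_{r→0⁺} r² k_x(r) = 0 for every x ∈ S^{d−1}. Then for every f ∈ C_c^∞(ℝ^d) with E f(X) = 0, one has E[f(X)²] ≤ E[∫_{ℝ^d} (f(X+u) − f(X))² ν(du)]. -/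
open MeasureTheory ProbabilityTheory Filter Set
open scoped RealInnerProductSpace ENNReal NNReal Topology

noncomputable section

/-- A Lévy measure on `ℝ^d`. -/
def IsLevyMeasure {d : ℕ} (ν : Measure (EuclideanSpace ℝ (Fin d))) : Prop :=
  ν {0} = 0 ∧ ∫⁻ u, ENNReal.ofReal (min 1 (‖u‖ ^ 2)) ∂ν < ⊤

/-- The characteristic function of a measure on `ℝ^d`. -/
def charFn {d : ℕ} (μ : Measure (EuclideanSpace ℝ (Fin d)))
    (ξ : EuclideanSpace ℝ (Fin d)) : ℂ :=
  ∫ x, Complex.exp (Complex.I * (⟪ξ, x⟫ : ℂ)) ∂μ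

open scoped ComplexConjugate FourierTransform

/-- The integral over `ρ` of the squared modulus of a superposition `∫ G x y ∂κ x`, expanded as a
sesquilinear double integral. -/
lemma integral_norm_sq_integral {X Y : Type*} [MeasurableSpace X] [MeasurableSpace Y]
    {κ : Measure X} {ρ : Measure Y} [SFinite κ] [SFinite ρ] {G : X → Y → ℂ}
    (hG : Measurable (Function.uncurry G)) {w : X → ℝ} {m : Y → ℝ}
    (hw : Integrable w κ) (hm : Integrable (fun y => m y ^ 2) ρ)
    (hb : ∀ x y, ‖G x y‖ ≤ w x * m y) :
    ∫ p : X × X, ∫ y, G p.1 y * conj (G p.2 y) ∂ρ ∂(κ.prod κ)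
      = ((∫ y, ‖∫ x, G x y ∂κ‖ ^ 2 ∂ρ : ℝ) : ℂ) := by
  have hmeas : Measurable (fun q : (X × X) × Y => G q.1.1 q.2 * conj (G q.1.2 q.2)) := by
    have h1 : Measurable (fun q : (X × X) × Y => G q.1.1 q.2) :=
      hG.comp (measurable_fst.fst.prodMk measurable_snd)
    have h2 : Measurable (fun q : (X × X) × Y => G q.1.2 q.2) :=
      hG.comp (measurable_fst.snd.prodMk measurable_snd)
    exact h1.mul (Complex.continuous_conj.measurable.comp h2)
  have hint : Integrable (fun q : (X × X) × Y => G q.1.1 q.2 * conj (G q.1.2 q.2))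
      ((κ.prod κ).prod ρ) := by
    refine ((hw.mul_prod hw).mul_prod hm).mono' hmeas.aestronglyMeasurable (ae_of_all _ ?_)
    rintro ⟨⟨x, x'⟩, y⟩
    rw [norm_mul, RCLike.norm_conj]
    calc ‖G x y‖ * ‖G x' y‖ ≤ (w x * m y) * (w x' * m y) :=
          mul_le_mul (hb x y) (hb x' y) (norm_nonneg _) ((norm_nonneg _).trans (hb x y))
      _ = w x * w x' * m y ^ 2 := by ring
  rw [integral_integral_swap hint, ← integral_complex_ofReal]
  refine integral_congr_ae (ae_of_all _ fun y => ?_)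
  simp only
  rw [integral_prod_mul (fun x => G x y) (fun x => conj (G x y)), integral_conj,
    Complex.mul_conj, Complex.normSq_eq_norm_sq]

section PlaneWave

variable {V : Type*} [NormedAddCommGroup V] [InnerProductSpace ℝ V]

/-- The plane wave `x ↦ exp (2πi ⟪ξ, x⟫)`. -/
def planeWave (ξ x : V) : ℂ := Complex.exp (((2 * Real.pi * ⟪ξ, x⟫ : ℝ) : ℂ) * Complex.I)

lemma continuous_planeWave : Continuous (fun p : V × V => planeWave p.1 p.2) := by
  unfold planeWave; fun_prop

lemma norm_planeWave (ξ x : V) : ‖planeWave ξ x‖ = 1 := Complex.norm_exp_ofReal_mul_I _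

lemma conj_planeWave (ξ x : V) : conj (planeWave ξ x) = planeWave (-ξ) x := by
  simp [planeWave, ← Complex.exp_conj, Complex.conj_ofNat]

lemma planeWave_add_left (ξ η x : V) :
    planeWave (ξ + η) x = planeWave ξ x * planeWave η x := by
  rw [planeWave, planeWave, planeWave, ← Complex.exp_add]
  congr 1
  rw [inner_add_left]; push_cast; ring

lemma planeWave_sub_left (ξ η x : V) :
    planeWave (ξ - η) x = planeWave ξ x * conj (planeWave η x) := by
  rw [sub_eq_add_neg, planeWave_add_left, conj_planeWave]

lemma planeWave_add_right (ξ x y : V) :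
    planeWave ξ (x + y) = planeWave ξ x * planeWave ξ y := by
  rw [planeWave, planeWave, planeWave, ← Complex.exp_add]
  congr 1
  rw [inner_add_right]; push_cast; ring

lemma norm_planeWave_sub_one_le (ξ u : V) :
    ‖planeWave ξ u - 1‖ ≤ (2 + 2 * Real.pi * ‖ξ‖) * min 1 ‖u‖ := by
  have hπ := Real.pi_pos
  have h1 : ‖planeWave ξ u - 1‖ ≤ 2 := by
    refine (norm_sub_le _ _).trans ?_
    rw [norm_planeWave, norm_one]; norm_num
  have h2 : ‖planeWave ξ u - 1‖ ≤ 2 * Real.pi * (‖ξ‖ * ‖u‖) := by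
    rw [planeWave, mul_comm]
    refine Real.norm_exp_I_mul_ofReal_sub_one_le.trans ?_
    rw [norm_mul, Real.norm_of_nonneg (by positivity : 0 ≤ 2 * Real.pi)]
    exact mul_le_mul_of_nonneg_left (norm_inner_le_norm ξ u) (by positivity)
  have : 0 ≤ 2 * Real.pi * ‖ξ‖ := by positivity
  rcases le_total 1 ‖u‖ with h | h
  · rw [min_eq_left h]; linarith
  · rw [min_eq_right h]; nlinarith [norm_nonneg u]

variable [MeasurableSpace V]

/-- The increment kernel `∫ (e_ξ(u) - 1) conj (e_η(u) - 1) ν(du)`. -/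
def incrementKernel (ν : Measure V) (ξ η : V) : ℂ :=
  ∫ u, (planeWave ξ u - 1) * conj (planeWave η u - 1) ∂ν

lemma incrementKernel_self (ν : Measure V) (ξ : V) :
    incrementKernel ν ξ ξ = ((∫ u, ‖planeWave ξ u - 1‖ ^ 2 ∂ν : ℝ) : ℂ) := by
  rw [incrementKernel, ← integral_complex_ofReal]
  refine integral_congr_ae (ae_of_all _ fun u => ?_)
  simp only
  rw [Complex.mul_conj, Complex.normSq_eq_norm_sq]

lemma norm_incrementKernel_le_mul {ν : Measure V}
    (hν : Integrable (fun u => (min 1 ‖u‖) ^ 2) ν) (ξ η : V) :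
    ‖incrementKernel ν ξ η‖ ≤ (∫ u, (min 1 ‖u‖) ^ 2 ∂ν) *
      ((2 + 2 * Real.pi * ‖ξ‖) * (2 + 2 * Real.pi * ‖η‖)) := by
  rw [mul_comm, ← integral_const_mul]
  refine norm_integral_le_of_norm_le (hν.const_mul _) (ae_of_all _ fun u => ?_)
  rw [norm_mul, RCLike.norm_conj]
  refine (mul_le_mul (norm_planeWave_sub_one_le ξ u) (norm_planeWave_sub_one_le η u)
    (norm_nonneg _) (by positivity)).trans_eq ?_
  ring

variable [BorelSpace V]

lemma integrable_planeWave_sub_one_mul {ν : Measure V}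
    (hν : Integrable (fun u => (min 1 ‖u‖) ^ 2) ν) (ξ η : V) :
    Integrable (fun u => (planeWave ξ u - 1) * conj (planeWave η u - 1)) ν := by
  refine (hν.const_mul ((2 + 2 * Real.pi * ‖ξ‖) * (2 + 2 * Real.pi * ‖η‖))).mono'
    (Continuous.aestronglyMeasurable (by unfold planeWave; fun_prop)) (ae_of_all _ fun u => ?_)
  rw [norm_mul, RCLike.norm_conj]
  refine (mul_le_mul (norm_planeWave_sub_one_le ξ u) (norm_planeWave_sub_one_le η u)
    (norm_nonneg _) (by positivity)).trans_eq ?_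
  ring

lemma norm_incrementKernel_le {ν : Measure V}
    (hν : Integrable (fun u => (min 1 ‖u‖) ^ 2) ν) (ξ η : V) :
    ‖incrementKernel ν ξ η‖ ≤
      ((incrementKernel ν ξ ξ).re + (incrementKernel ν η η).re) / 2 := by
  have hsq : ∀ ζ : V, Integrable (fun u => ‖planeWave ζ u - 1‖ ^ 2) ν := fun ζ => by
    refine (integrable_planeWave_sub_one_mul hν ζ ζ).norm.congr (ae_of_all _ fun u => ?_)
    simp only
    rw [norm_mul, RCLike.norm_conj, sq]
  rw [incrementKernel_self, incrementKernel_self, Complex.ofReal_re, Complex.ofReal_re,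
    ← integral_add (hsq ξ) (hsq η), ← integral_div]
  refine norm_integral_le_of_norm_le (((hsq ξ).add (hsq η)).div_const 2)
    (ae_of_all _ fun u => ?_)
  rw [norm_mul, RCLike.norm_conj]
  nlinarith [sq_nonneg (‖planeWave ξ u - 1‖ - ‖planeWave η u - 1‖)]

variable [SecondCountableTopology V]

lemma measurable_planeWave : Measurable (fun p : V × V => planeWave p.1 p.2) :=
  continuous_planeWave.measurable

lemma measurable_incrementKernel (ν : Measure V) [SFinite ν] :
    Measurable (fun p : V × V => incrementKernel ν p.1 p.2) := by
  refine StronglyMeasurable.measurable ?_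
  refine StronglyMeasurable.integral_prod_right' (f := fun q : (V × V) × V =>
    (planeWave q.1.1 q.2 - 1) * conj (planeWave q.1.2 q.2 - 1)) ?_
  refine Continuous.stronglyMeasurable ?_
  unfold planeWave; fun_prop

/-- The chaos coefficients of a superposition of plane waves: powers of the increment kernel are
positive definite. -/
lemma integral_mul_incrementKernel_pow {κ ν : Measure V} [SFinite κ] [SigmaFinite ν]
    (hν : Integrable (fun u => (min 1 ‖u‖) ^ 2) ν) {h : V → ℂ} (hh : Measurable h) (n : ℕ)
    (hhint : Integrable (fun ξ => ‖h ξ‖ * (2 + 2 * Real.pi * ‖ξ‖) ^ n) κ) :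
    ∫ p : V × V, h p.1 * conj (h p.2) * incrementKernel ν p.1 p.2 ^ n ∂(κ.prod κ)
      = ((∫ y : Fin n → V, ‖∫ ξ, h ξ * ∏ j, (planeWave ξ (y j) - 1) ∂κ‖ ^ 2
          ∂(Measure.pi fun _ => ν) : ℝ) : ℂ) := by
  rw [← integral_norm_sq_integral (G := fun ξ (y : Fin n → V) =>
    h ξ * ∏ j, (planeWave ξ (y j) - 1)) (m := fun y => ∏ j, min 1 ‖y j‖) ?_ hhint ?_ ?_]
  · refine integral_congr_ae (ae_of_all _ fun p => ?_)
    simp only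
    have := integral_fintype_prod_eq_pow (ι := Fin n) (μ := ν)
      (fun u => (planeWave p.1 u - 1) * conj (planeWave p.2 u - 1))
    rw [Fintype.card_fin] at this
    rw [incrementKernel, ← this, ← integral_const_mul]
    refine integral_congr_ae (ae_of_all _ fun y => ?_)
    simp only [map_mul, map_prod, Finset.prod_mul_distrib]
    ring
  · refine (hh.comp measurable_fst).mul ?_
    refine Finset.measurable_prod _ fun j _ => ?_
    have hj : Measurable (fun q : V × (Fin n → V) => q.2 j) := by fun_prop
    exact (measurable_planeWave.comp (measurable_fst.prodMk hj)).sub_const 1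
  · simp_rw [← Finset.prod_pow]
    exact Integrable.fintype_prod (f := fun _ u => (min 1 ‖u‖) ^ 2) (μ := fun _ => ν) fun _ => hν
  · intro ξ y
    rw [norm_mul, norm_prod, mul_assoc]
    refine mul_le_mul_of_nonneg_left ?_ (norm_nonneg _)
    calc ∏ j, ‖planeWave ξ (y j) - 1‖
        ≤ ∏ j, ((2 + 2 * Real.pi * ‖ξ‖) * min 1 ‖y j‖) :=
          Finset.prod_le_prod (fun _ _ => norm_nonneg _)
            fun j _ => norm_planeWave_sub_one_le ξ (y j)
      _ = _ := by rw [Finset.prod_mul_distrib]; simp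

end PlaneWave

section Poincare

variable {V : Type*} [NormedAddCommGroup V] [InnerProductSpace ℝ V] [MeasurableSpace V]

/-- The characteristic function of `μ` in the `2π`-normalisation of the Fourier transform. -/
def planeWaveIntegral (μ : Measure V) (ξ : V) : ℂ := ∫ x, planeWave ξ x ∂μ

lemma norm_mul_norm_mul_exp_incrementKernel_le {μ ν : Measure V} [IsProbabilityMeasure μ]
    [BorelSpace V] (hν : Integrable (fun u => (min 1 ‖u‖) ^ 2) ν)
    (hμ : ∀ ξ η, planeWaveIntegral μ (ξ - η) = planeWaveIntegral μ ξ *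
      conj (planeWaveIntegral μ η) * Complex.exp (incrementKernel ν ξ η)) (ξ η : V) :
    ‖planeWaveIntegral μ ξ‖ * ‖planeWaveIntegral μ η‖ *
      Real.exp ‖incrementKernel ν ξ η‖ ≤ 1 := by
  have hdiag : ∀ ζ, ‖planeWaveIntegral μ ζ‖ ^ 2 *
      Real.exp (incrementKernel ν ζ ζ).re = 1 := fun ζ => by
    have h := congrArg norm (hμ ζ ζ)
    rw [norm_mul, norm_mul, RCLike.norm_conj, Complex.norm_exp, ← sq] at h
    rw [← h]
    simp [planeWaveIntegral, planeWave]
  have hsq : (‖planeWaveIntegral μ ξ‖ * ‖planeWaveIntegral μ η‖ *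
      Real.exp ‖incrementKernel ν ξ η‖) ^ 2 ≤ 1 := by
    calc _ = ‖planeWaveIntegral μ ξ‖ ^ 2 * ‖planeWaveIntegral μ η‖ ^ 2 *
          Real.exp (2 * ‖incrementKernel ν ξ η‖) := by
          rw [mul_pow, mul_pow, ← Real.exp_nat_mul]; norm_num
      _ ≤ ‖planeWaveIntegral μ ξ‖ ^ 2 * ‖planeWaveIntegral μ η‖ ^ 2 *
          Real.exp ((incrementKernel ν ξ ξ).re + (incrementKernel ν η η).re) := by
          gcongr
          linarith [norm_incrementKernel_le hν ξ η]
      _ = (‖planeWaveIntegral μ ξ‖ ^ 2 * Real.exp (incrementKernel ν ξ ξ).re) *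
          (‖planeWaveIntegral μ η‖ ^ 2 * Real.exp (incrementKernel ν η η).re) := by
          rw [Real.exp_add]; ring
      _ = 1 := by rw [hdiag, hdiag, one_mul]
  nlinarith

variable [BorelSpace V] [SecondCountableTopology V]

lemma measurable_planeWaveIntegral (μ : Measure V) [SFinite μ] :
    Measurable (planeWaveIntegral μ) :=
  (StronglyMeasurable.integral_prod_right' (f := fun p : V × V => planeWave p.1 p.2)
    continuous_planeWave.stronglyMeasurable).measurable

/-- Expansion of `exp` of the increment kernel under the double frequency integral. -/
lemma hasSum_integral_incrementKernel_pow {κ μ ν : Measure V} [SFinite κ]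
    [IsProbabilityMeasure μ] [SFinite ν] (hν : Integrable (fun u => (min 1 ‖u‖) ^ 2) ν)
    (hμ : ∀ ξ η, planeWaveIntegral μ (ξ - η) = planeWaveIntegral μ ξ *
      conj (planeWaveIntegral μ η) * Complex.exp (incrementKernel ν ξ η))
    {F : V → ℂ} (hF : Measurable F)
    (hFint : ∀ n : ℕ, Integrable (fun ξ => ‖F ξ‖ * (2 + 2 * Real.pi * ‖ξ‖) ^ n) κ) (j : ℕ) :
    HasSum (fun n : ℕ => ((n.factorial : ℂ))⁻¹ *
        ∫ p : V × V, (F p.1 * planeWaveIntegral μ p.1) *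
          conj (F p.2 * planeWaveIntegral μ p.2) * incrementKernel ν p.1 p.2 ^ (n + j) ∂(κ.prod κ))
      (∫ p : V × V, F p.1 * conj (F p.2) *
        (planeWaveIntegral μ (p.1 - p.2) * incrementKernel ν p.1 p.2 ^ j) ∂(κ.prod κ)) := by
  have hΦ := measurable_planeWaveIntegral μ
  have hK := measurable_incrementKernel ν
  have hh : Measurable (fun ξ => F ξ * planeWaveIntegral μ ξ) := hF.mul hΦ
  have hH : Measurable (fun p : V × V => (F p.1 * planeWaveIntegral μ p.1) *
      conj (F p.2 * planeWaveIntegral μ p.2)) :=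
    (hh.comp measurable_fst).mul (Complex.continuous_conj.measurable.comp (hh.comp measurable_snd))
  simp_rw [← integral_const_mul]
  set a : ℕ → V × V → ℝ := fun n p => ‖F p.1‖ * ‖F p.2‖ * ‖planeWaveIntegral μ p.1‖ *
    ‖planeWaveIntegral μ p.2‖ * ‖incrementKernel ν p.1 p.2‖ ^ j *
    (‖incrementKernel ν p.1 p.2‖ ^ n / n.factorial) with ha
  have hasum : ∀ p, HasSum (fun n => a n p) (‖F p.1‖ * ‖F p.2‖ * ‖planeWaveIntegral μ p.1‖ *
      ‖planeWaveIntegral μ p.2‖ * ‖incrementKernel ν p.1 p.2‖ ^ j *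
      Real.exp ‖incrementKernel ν p.1 p.2‖) := fun p => by
    refine HasSum.mul_left _ ?_
    rw [Real.exp_eq_exp_ℝ]
    exact NormedSpace.expSeries_div_hasSum_exp _
  refine hasSum_integral_of_dominated_convergence a ?_ ?_ ?_ ?_ ?_
  · exact fun n => ((hH.mul (hK.pow_const _)).const_mul _).aestronglyMeasurable
  · refine fun n => ae_of_all _ fun p => le_of_eq ?_
    simp only [ha, norm_mul, norm_inv, norm_pow, RCLike.norm_conj, Complex.norm_natCast]
    rw [pow_add]
    ring
  · exact ae_of_all _ fun p => (hasum p).summable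
  · simp_rw [fun p => (hasum p).tsum_eq]
    refine (((hFint j).mul_prod (hFint j)).const_mul ((∫ u, (min 1 ‖u‖) ^ 2 ∂ν) ^ j)).mono'
      ?_ (ae_of_all _ fun p => ?_)
    · refine Measurable.aestronglyMeasurable ?_
      exact ((((((hF.comp measurable_fst).norm.mul (hF.comp measurable_snd).norm).mul
        (hΦ.comp measurable_fst).norm).mul (hΦ.comp measurable_snd).norm).mul
        (hK.norm.pow_const j))).mul (Real.measurable_exp.comp hK.norm)
    · rw [Real.norm_of_nonneg (by positivity)]
      calc _ = ‖F p.1‖ * ‖F p.2‖ * ‖incrementKernel ν p.1 p.2‖ ^ j *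
            (‖planeWaveIntegral μ p.1‖ * ‖planeWaveIntegral μ p.2‖ *
              Real.exp ‖incrementKernel ν p.1 p.2‖) := by ring
        _ ≤ ‖F p.1‖ * ‖F p.2‖ * ((∫ u, (min 1 ‖u‖) ^ 2 ∂ν) *
              ((2 + 2 * Real.pi * ‖p.1‖) * (2 + 2 * Real.pi * ‖p.2‖))) ^ j * 1 := by
            gcongr
            · exact norm_incrementKernel_le_mul hν _ _
            · exact norm_mul_norm_mul_exp_incrementKernel_le hν hμ _ _
        _ = _ := by rw [mul_pow, mul_pow]; ring
  · refine ae_of_all _ fun p => ?_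
    have h := NormedSpace.expSeries_div_hasSum_exp (incrementKernel ν p.1 p.2)
    rw [← Complex.exp_eq_exp_ℂ] at h
    rw [hμ, map_mul]
    convert! h.mul_left ((F p.1 * planeWaveIntegral μ p.1) *
      (conj (F p.2) * conj (planeWaveIntegral μ p.2)) * incrementKernel ν p.1 p.2 ^ j)
      using 1
    · ext n; rw [pow_add]; ring
    · ring

/-- **Poincaré inequality** for a probability measure whose characteristic function `Φ` satisfies
`Φ (ξ - η) = Φ ξ * conj (Φ η) * exp K`, with `K` the increment kernel of `ν`, and a function with
a rapidly decaying frequency density. -/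
theorem integral_sq_le_of_planeWaveIntegral {κ μ ν : Measure V} [SFinite κ]
    [IsProbabilityMeasure μ] [SigmaFinite ν] (hν : Integrable (fun u => (min 1 ‖u‖) ^ 2) ν)
    (hμ : ∀ ξ η, planeWaveIntegral μ (ξ - η) = planeWaveIntegral μ ξ *
      conj (planeWaveIntegral μ η) * Complex.exp (incrementKernel ν ξ η))
    {F : V → ℂ} (hF : Measurable F)
    (hFint : ∀ n : ℕ, Integrable (fun ξ => ‖F ξ‖ * (2 + 2 * Real.pi * ‖ξ‖) ^ n) κ)
    {f : V → ℝ} (hfm : Measurable f) (hf : ∀ x, (f x : ℂ) = ∫ ξ, F ξ * planeWave ξ x ∂κ)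
    (hmean : ∫ x, f x ∂μ = 0) :
    ∫ x, f x ^ 2 ∂μ ≤ ∫ x, ∫ u, (f (x + u) - f x) ^ 2 ∂ν ∂μ := by
  have hF0 : Integrable (fun ξ => ‖F ξ‖) κ := by simpa using hFint 0
  have hFe : ∀ x, Integrable (fun ξ => F ξ * planeWave ξ x) κ := fun x =>
    hF0.mono' (hF.mul (measurable_planeWave.comp
      (measurable_id.prodMk measurable_const))).aestronglyMeasurable
      (ae_of_all _ fun ξ => by rw [norm_mul, norm_planeWave, mul_one])
  -- frequency representation of the variance
  have hvar : ∫ p : V × V, F p.1 * conj (F p.2) *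
      (planeWaveIntegral μ (p.1 - p.2) * incrementKernel ν p.1 p.2 ^ 0) ∂(κ.prod κ)
      = ((∫ x, f x ^ 2 ∂μ : ℝ) : ℂ) := by
    have h := integral_norm_sq_integral (κ := κ) (ρ := μ)
      (G := fun ξ x => F ξ * planeWave ξ x) (m := fun _ => 1)
      ((hF.comp measurable_fst).mul measurable_planeWave) hF0 (integrable_const _)
      (fun ξ x => by rw [norm_mul, norm_planeWave])
    simp only [← hf, Complex.norm_real, Real.norm_eq_abs, sq_abs] at h
    rw [← h]
    refine integral_congr_ae (ae_of_all _ fun p => ?_)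
    simp only [pow_zero, mul_one, planeWaveIntegral]
    rw [← integral_const_mul]
    refine integral_congr_ae (ae_of_all _ fun x => ?_)
    simp only [planeWave_sub_left, map_mul]
    ring
  -- frequency representation of the energy
  have hincr : ∀ x u, ((f (x + u) - f x : ℝ) : ℂ)
      = ∫ ξ, F ξ * planeWave ξ x * (planeWave ξ u - 1) ∂κ := fun x u => by
    rw [Complex.ofReal_sub, hf, hf, ← integral_sub (hFe _) (hFe _)]
    refine integral_congr_ae (ae_of_all _ fun ξ => ?_)
    simp only [planeWave_add_right]
    ring
  have hm : Integrable (fun y : V × V => (min 1 ‖y.2‖) ^ 2) (μ.prod ν) := by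
    simpa using (integrable_const (1 : ℝ)).mul_prod (μ := μ) hν
  have hGb : ∀ (ξ : V) (y : V × V), ‖F ξ * planeWave ξ y.1 * (planeWave ξ y.2 - 1)‖
      ≤ ‖F ξ‖ * (2 + 2 * Real.pi * ‖ξ‖) ^ 1 * min 1 ‖y.2‖ := fun ξ y => by
    rw [norm_mul, norm_mul, norm_planeWave, mul_one, pow_one, mul_assoc]
    exact mul_le_mul_of_nonneg_left (norm_planeWave_sub_one_le _ _) (norm_nonneg _)
  have henergy_int : Integrable (fun y : V × V => (f (y.1 + y.2) - f y.1) ^ 2) (μ.prod ν) := by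
    refine (hm.const_mul ((∫ ξ, ‖F ξ‖ * (2 + 2 * Real.pi * ‖ξ‖) ^ 1 ∂κ) ^ 2)).mono'
      (((hfm.comp (measurable_fst.add measurable_snd)).sub
        (hfm.comp measurable_fst)).pow_const 2).aestronglyMeasurable (ae_of_all _ fun y => ?_)
    rw [norm_pow, ← mul_pow]
    refine pow_le_pow_left₀ (norm_nonneg _) ?_ 2
    rw [← Complex.norm_real, hincr, ← integral_mul_const]
    exact norm_integral_le_of_norm_le ((hFint 1).mul_const _) (ae_of_all _ fun ξ => hGb ξ y)
  have henergy : ∫ p : V × V, F p.1 * conj (F p.2) *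
      (planeWaveIntegral μ (p.1 - p.2) * incrementKernel ν p.1 p.2 ^ 1) ∂(κ.prod κ)
      = ((∫ x, ∫ u, (f (x + u) - f x) ^ 2 ∂ν ∂μ : ℝ) : ℂ) := by
    have h := integral_norm_sq_integral (κ := κ) (ρ := μ.prod ν)
      (G := fun ξ y => F ξ * planeWave ξ y.1 * (planeWave ξ y.2 - 1))
      (m := fun y => min 1 ‖y.2‖)
      (((hF.comp measurable_fst).mul (measurable_planeWave.comp
        (measurable_fst.prodMk measurable_snd.fst))).mul
        ((measurable_planeWave.comp (measurable_fst.prodMk measurable_snd.snd)).sub_const 1))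
      (hFint 1) hm hGb
    simp only [← hincr, Complex.norm_real, Real.norm_eq_abs, sq_abs] at h
    rw [integral_prod _ henergy_int] at h
    rw [← h]
    refine integral_congr_ae (ae_of_all _ fun p => ?_)
    simp only [pow_one, planeWaveIntegral, incrementKernel]
    rw [← integral_prod_mul, ← integral_const_mul]
    refine integral_congr_ae (ae_of_all _ fun y => ?_)
    simp only [planeWave_sub_left, map_mul]
    ring
  set s : ℕ → ℝ := fun n => ∫ y : Fin n → V, ‖∫ ξ, F ξ * planeWaveIntegral μ ξ *
    ∏ j, (planeWave ξ (y j) - 1) ∂κ‖ ^ 2 ∂(Measure.pi fun _ => ν) with hs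
  have hs_nonneg : ∀ n, 0 ≤ s n := fun n => integral_nonneg fun y => by positivity
  have hΦm := measurable_planeWaveIntegral μ
  have hΦ1 : ∀ ξ, ‖planeWaveIntegral μ ξ‖ ≤ 1 := fun ξ => by
    simpa [planeWaveIntegral] using norm_integral_le_of_norm_le (μ := μ) (integrable_const (1 : ℝ))
      (ae_of_all _ fun x => (norm_planeWave ξ x).le)
  have hpow : ∀ n, ∫ p : V × V, (F p.1 * planeWaveIntegral μ p.1) *
      conj (F p.2 * planeWaveIntegral μ p.2) * incrementKernel ν p.1 p.2 ^ n ∂(κ.prod κ)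
      = (s n : ℂ) := fun n => by
    refine integral_mul_incrementKernel_pow hν (hF.mul hΦm) n ?_
    refine (hFint n).mono' ?_ (ae_of_all _ fun ξ => ?_)
    · exact ((hF.mul hΦm).norm.mul (by fun_prop)).aestronglyMeasurable
    · rw [norm_mul, norm_norm, Pi.mul_apply, norm_mul, Real.norm_of_nonneg (by positivity)]
      refine mul_le_mul_of_nonneg_right ?_ (by positivity)
      exact mul_le_of_le_one_right (norm_nonneg _) (hΦ1 ξ)
  have hs0 : s 0 = 0 := by
    have hzero : ∫ ξ, F ξ * planeWaveIntegral μ ξ ∂κ = 0 := by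
      have hswap := integral_integral_swap (f := fun ξ x => F ξ * planeWave ξ x)
        (μ := κ) (ν := μ) ((hF0.mul_prod (integrable_const (1 : ℝ))).mono'
          ((hF.comp measurable_fst).mul measurable_planeWave).aestronglyMeasurable
          (ae_of_all _ fun q => by
            simp only [Function.uncurry]; rw [norm_mul, norm_planeWave]))
      simp only [← hf, integral_const_mul, integral_complex_ofReal, hmean] at hswap
      simpa [planeWaveIntegral] using hswap
    simp [hs, hzero]
  have hsum : ∀ j (A : ℝ), ∫ p : V × V, F p.1 * conj (F p.2) *
      (planeWaveIntegral μ (p.1 - p.2) * incrementKernel ν p.1 p.2 ^ j) ∂(κ.prod κ) = (A : ℂ) →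
      HasSum (fun n : ℕ => (n.factorial : ℝ)⁻¹ * s (n + j)) A := fun j A hA => by
    have h := hasSum_integral_incrementKernel_pow hν hμ hF hFint j
    simp only [hpow, hA] at h
    rw [← Complex.hasSum_ofReal]
    simpa using h
  have h0 := hsum 0 _ hvar
  have h1 := hsum 1 _ henergy
  rw [← hasSum_nat_add_iff' 1] at h0
  simp only [Finset.range_one, Finset.sum_singleton, add_zero, hs0, mul_zero, sub_zero] at h0
  refine hasSum_le (fun n => ?_) h0 h1
  refine mul_le_mul_of_nonneg_right ?_ (hs_nonneg _)
  gcongr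
  exact Nat.le_succ n

end Poincare

section Levy

variable {d : ℕ} {μ ν : Measure (EuclideanSpace ℝ (Fin d))}

lemma IsLevyMeasure.sigmaFinite (hν : IsLevyMeasure ν) : SigmaFinite ν := by
  set g : EuclideanSpace ℝ (Fin d) → ℝ≥0∞ := fun u => ENNReal.ofReal (min 1 (‖u‖ ^ 2))
  have hg : Measurable g := by fun_prop
  have : IsFiniteMeasure (ν.withDensity g) := isFiniteMeasure_withDensity hν.2.ne
  have hg0 : ∀ᵐ u ∂ν, g u ≠ 0 := by
    have h0 : ∀ᵐ u ∂ν, u ≠ 0 := by simpa [ae_iff] using hν.1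
    filter_upwards [h0] with u hu
    simpa [g] using hu
  rw [← withDensity_inv_same hg hg0 (ae_of_all _ fun u => ENNReal.ofReal_ne_top)]
  refine SigmaFinite.withDensity_of_ne_top ?_
  exact (withDensity_absolutelyContinuous ν g).ae_le (by
    filter_upwards [hg0] with u hu
    simpa using hu)

lemma IsLevyMeasure.integrable_min_sq (hν : IsLevyMeasure ν) :
    Integrable (fun u => (min 1 ‖u‖) ^ 2) ν := by
  have h : ∀ u : EuclideanSpace ℝ (Fin d), (min 1 ‖u‖) ^ 2 = min 1 (‖u‖ ^ 2) := fun u => by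
    rcases le_total 1 ‖u‖ with hu | hu
    · rw [min_eq_left hu, min_eq_left (one_le_pow₀ hu), one_pow]
    · rw [min_eq_right hu, min_eq_right (pow_le_one₀ (norm_nonneg _) hu)]
  simp_rw [h]
  refine ⟨by fun_prop, ?_⟩
  rw [hasFiniteIntegral_iff_ofReal (ae_of_all _ fun u => by positivity)]
  exact hν.2

/-- The integrand of the Lévy–Khintchine formula. -/
def levyIntegrand (ξ u : EuclideanSpace ℝ (Fin d)) : ℂ :=
  Complex.exp (Complex.I * ((⟪ξ, u⟫ : ℝ) : ℂ)) - 1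
    - (if ‖u‖ ≤ 1 then Complex.I * ((⟪ξ, u⟫ : ℝ) : ℂ) else 0)

lemma norm_exp_I_mul_sub_one_sub_le (t : ℝ) :
    ‖Complex.exp (Complex.I * t) - 1 - Complex.I * t‖ ≤ 2 * t ^ 2 := by
  have ht : ‖Complex.I * (t : ℂ)‖ = |t| := by simp
  rcases le_total |t| 1 with h | h
  · have := Complex.norm_exp_sub_one_sub_id_le (ht.trans_le h)
    rw [ht, sq_abs] at this
    nlinarith [sq_nonneg t]
  · refine (norm_sub_le _ _).trans ?_
    have := Real.norm_exp_I_mul_ofReal_sub_one_le (x := t)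
    rw [ht]
    rw [Real.norm_eq_abs] at this
    nlinarith [sq_abs t]

lemma IsLevyMeasure.integrable_levyIntegrand (hν : IsLevyMeasure ν)
    (ξ : EuclideanSpace ℝ (Fin d)) : Integrable (levyIntegrand ξ) ν := by
  refine (hν.integrable_min_sq.const_mul (2 + 2 * ‖ξ‖ ^ 2)).mono' ?_ (ae_of_all _ fun u => ?_)
  · refine Measurable.aestronglyMeasurable ?_
    unfold levyIntegrand
    refine Measurable.sub (by fun_prop) (Measurable.ite ?_ (by fun_prop) measurable_const)
    exact measurableSet_le measurable_norm measurable_const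
  · have hξ : (0 : ℝ) ≤ ‖ξ‖ ^ 2 := by positivity
    unfold levyIntegrand
    split_ifs with hu
    · refine (norm_exp_I_mul_sub_one_sub_le _).trans ?_
      have h := abs_real_inner_le_norm ξ u
      have h2 : ⟪ξ, u⟫ ^ 2 ≤ ‖ξ‖ ^ 2 * ‖u‖ ^ 2 := by
        rw [← sq_abs, ← mul_pow]; exact pow_le_pow_left₀ (abs_nonneg _) h 2
      rw [min_eq_right hu]
      nlinarith [sq_nonneg ‖u‖]
    · rw [min_eq_left (not_le.1 hu).le, sub_zero]
      refine (norm_sub_le _ _).trans ?_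
      rw [mul_comm Complex.I, Complex.norm_exp_ofReal_mul_I, norm_one]
      linarith

lemma planeWave_eq (ξ u : EuclideanSpace ℝ (Fin d)) :
    planeWave ξ u = Complex.exp (Complex.I * ((⟪(2 * Real.pi) • ξ, u⟫ : ℝ) : ℂ)) := by
  rw [planeWave, real_inner_smul_left, mul_comm]

lemma planeWaveIntegral_eq_charFn (ξ : EuclideanSpace ℝ (Fin d)) :
    planeWaveIntegral μ ξ = charFn μ ((2 * Real.pi) • ξ) := by
  simp only [planeWaveIntegral, charFn, planeWave_eq]

lemma conj_planeWaveIntegral (ξ : EuclideanSpace ℝ (Fin d)) :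
    conj (planeWaveIntegral μ ξ) = planeWaveIntegral μ (-ξ) := by
  simp only [planeWaveIntegral, ← integral_conj, conj_planeWave]

lemma IsLevyMeasure.integral_levyIntegrand_sub (hν : IsLevyMeasure ν)
    (ξ η : EuclideanSpace ℝ (Fin d)) :
    ∫ u, levyIntegrand ((2 * Real.pi) • (ξ - η)) u ∂ν
      = ∫ u, levyIntegrand ((2 * Real.pi) • ξ) u ∂ν + ∫ u, levyIntegrand ((2 * Real.pi) • -η) u ∂ν
        + incrementKernel ν ξ η := by
  have hi := hν.integrable_levyIntegrand
  rw [incrementKernel, ← integral_add' (hi _) (hi _), ← integral_add ((hi _).add (hi _))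
    (integrable_planeWave_sub_one_mul hν.integrable_min_sq ξ η)]
  refine integral_congr_ae (ae_of_all _ fun u => ?_)
  have hlin : ⟪(2 * Real.pi) • (ξ - η), u⟫
      = ⟪(2 * Real.pi) • ξ, u⟫ + ⟪(2 * Real.pi) • -η, u⟫ := by
    rw [← inner_add_left, ← smul_add, sub_eq_add_neg]
  simp only [Pi.add_apply, levyIntegrand, ← planeWave_eq, map_sub, map_one, conj_planeWave]
  rw [sub_eq_add_neg ξ η, planeWave_add_left, ← sub_eq_add_neg, hlin]
  split_ifs <;> push_cast <;> ring

/-- The Lévy–Khintchine formula in product form. -/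
lemma IsLevyMeasure.planeWaveIntegral_sub (hν : IsLevyMeasure ν)
    (b : EuclideanSpace ℝ (Fin d))
    (hchar : ∀ ξ, charFn μ ξ
      = Complex.exp (Complex.I * ((⟪b, ξ⟫ : ℝ) : ℂ) + ∫ u, levyIntegrand ξ u ∂ν))
    (ξ η : EuclideanSpace ℝ (Fin d)) :
    planeWaveIntegral μ (ξ - η) = planeWaveIntegral μ ξ * conj (planeWaveIntegral μ η) *
      Complex.exp (incrementKernel ν ξ η) := by
  rw [conj_planeWaveIntegral, planeWaveIntegral_eq_charFn, planeWaveIntegral_eq_charFn,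
    planeWaveIntegral_eq_charFn, hchar, hchar, hchar, ← Complex.exp_add, ← Complex.exp_add,
    hν.integral_levyIntegrand_sub]
  congr 1
  have hlin : ⟪b, (2 * Real.pi) • (ξ - η)⟫
      = ⟪b, (2 * Real.pi) • ξ⟫ + ⟪b, (2 * Real.pi) • -η⟫ := by
    rw [← inner_add_right, ← smul_add, sub_eq_add_neg]
  rw [hlin]
  push_cast
  ring

lemma SchwartzMap.integrable_norm_mul_pow (F : SchwartzMap (EuclideanSpace ℝ (Fin d)) ℂ) (n : ℕ) :
    Integrable (fun ξ => ‖F ξ‖ * (2 + 2 * Real.pi * ‖ξ‖) ^ n) := by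
  have h := ((F.integrable_pow_mul volume 0).const_mul (2 ^ (n - 1) * 2 ^ n)).add
    ((F.integrable_pow_mul volume n).const_mul (2 ^ (n - 1) * (2 * Real.pi) ^ n))
  refine h.mono' (Continuous.aestronglyMeasurable (by fun_prop)) (ae_of_all _ fun ξ => ?_)
  have hπ := Real.pi_pos
  rw [Real.norm_of_nonneg (by positivity)]
  refine (mul_le_mul_of_nonneg_left (add_pow_le (by norm_num : (0 : ℝ) ≤ 2)
    (by positivity : 0 ≤ 2 * Real.pi * ‖ξ‖) n) (norm_nonneg _)).trans_eq ?_
  simp only [Pi.add_apply]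
  rw [mul_pow _ ‖ξ‖]
  ring

end Levy

/-- Poincaré-type inequality for centered self-decomposable laws with finite first
moment (`prop:poincSD`). -/
theorem stmt7 {d : ℕ}
    (μX ν : Measure (EuclideanSpace ℝ (Fin d))) [IsProbabilityMeasure μX]
    (σ : Measure (EuclideanSpace ℝ (Fin d))) [IsFiniteMeasure σ]
    (b : EuclideanSpace ℝ (Fin d))
    (k : EuclideanSpace ℝ (Fin d) → ℝ → ℝ)
    (hσ : σ {x : EuclideanSpace ℝ (Fin d) | ¬ ‖x‖ = 1} = 0)
    (hLevy : IsLevyMeasure ν)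
    (hν1 : ∫⁻ u in {u : EuclideanSpace ℝ (Fin d) | 1 ≤ ‖u‖}, ENNReal.ofReal ‖u‖ ∂ν < ⊤)
    (hk0 : ∀ x, ∀ r : ℝ, 0 < r → 0 ≤ k x r)
    (hkcr : ∀ x, ContinuousOn (k x) (Ioi 0))
    (hkmono : ∀ x, AntitoneOn (k x) (Ioi 0))
    (hkcx : ∀ r : ℝ, 0 < r →
      ContinuousOn (fun x => k x r) {x : EuclideanSpace ℝ (Fin d) | ‖x‖ = 1})
    (hklim0 : ∀ x, ‖x‖ = 1 → Tendsto (fun r => r ^ 2 * k x r) (𝓝[>] 0) (𝓝 0))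
    (hkliminfty : ∀ x, ‖x‖ = 1 → Tendsto (k x) atTop (𝓝 0))
    (hpolar : ∀ g : EuclideanSpace ℝ (Fin d) → ℝ≥0∞, Measurable g →
      ∫⁻ u, g u ∂ν
        = ∫⁻ x, (∫⁻ r in Ioi (0 : ℝ), g (r • x) * ENNReal.ofReal (k x r / r)) ∂σ)
    (hchar : ∀ ξ, charFn μX ξ
      = Complex.exp (Complex.I * ((⟪b, ξ⟫ : ℝ) : ℂ)
          + ∫ u, (Complex.exp (Complex.I * ((⟪ξ, u⟫ : ℝ) : ℂ)) - 1
              - (if ‖u‖ ≤ 1 then Complex.I * ((⟪ξ, u⟫ : ℝ) : ℂ) else 0)) ∂ν))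
    (hcentered : (∫ x, x ∂μX) = 0) :
    ∀ f : EuclideanSpace ℝ (Fin d) → ℝ,
      ContDiff ℝ (⊤ : ℕ∞) f → HasCompactSupport f → (∫ x, f x ∂μX) = 0 →
      ∫ x, (f x) ^ 2 ∂μX ≤ ∫ x, ∫ u, (f (x + u) - f x) ^ 2 ∂ν ∂μX := by
  intro f hf hfc hmean
  have := hLevy.sigmaFinite
  let g : SchwartzMap (EuclideanSpace ℝ (Fin d)) ℂ :=
    (hfc.comp_left (g := ((↑) : ℝ → ℂ)) Complex.ofReal_zero).toSchwartzMap
      (Complex.ofRealCLM.contDiff.comp hf)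
  have hg : ∀ x, (f x : ℂ) = ∫ ξ, (𝓕 g) ξ * planeWave ξ x := fun x => by
    have h : (𝓕⁻ (𝓕 g)) x = g x := by rw [FourierTransform.fourierInv_fourier_eq]
    rw [SchwartzMap.fourierInv_coe, Real.fourierInv_eq'] at h
    refine h.symm.trans (integral_congr_ae (ae_of_all _ fun ξ => ?_))
    simp only [planeWave, smul_eq_mul]
    ring
  exact integral_sq_le_of_planeWaveIntegral hLevy.integrable_min_sq
    (hLevy.planeWaveIntegral_sub b hchar) (𝓕 g).continuous.measurable
    (𝓕 g).integrable_norm_mul_pow hf.continuous.measurable hg hmean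
end
end

section
/- Let ψ(x) = exp(−‖x‖²) for x ∈ ℝ^d, let α ∈ (1,2), and let X_α be a rotationally invariant α-stable random vector in ℝ^d with characteristic function φ(ξ) = exp(−‖ξ‖^α/2). For R ≥ 1 and j ∈ {1,…,d} let g_{R,j}(x) = x_j ψ(x/R). Then for every j, lim_{R→∞} E[g_{R,j}(X_α)²]/R^{2−α} = (α/2)(2π)^{−d} ∫_{ℝ^d} F(ψ²)(ξ) ( ‖ξ‖^{α−2} + ξ_j² (α−2) ‖ξ‖^{α−4} ) dξ. -/
open MeasureTheory ProbabilityTheory Filter Set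
open scoped RealInnerProductSpace ENNReal NNReal Topology

noncomputable section

/-- The Fourier transform `F(f)(ξ) = ∫ f(x) e^{−i⟨ξ,x⟩} dx` of a real function on `ℝ^d`. -/
def FT {d : ℕ} (f : EuclideanSpace ℝ (Fin d) → ℝ) (ξ : EuclideanSpace ℝ (Fin d)) : ℂ :=
  ∫ y, (f y : ℂ) * Complex.exp (-(Complex.I * ((⟪ξ, y⟫ : ℝ) : ℂ)))


lemma integral_norm_rpow_mul_exp_neg_mul_sq_norm {d : ℕ} (hd : 0 < d) {s b : ℝ}
    (hs : -(d : ℝ) < s) (hb : 0 < b) :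
    ∫ x : EuclideanSpace ℝ (Fin d), ‖x‖ ^ s * Real.exp (-b * ‖x‖ ^ 2) =
      d * volume.real (Metric.ball (0 : EuclideanSpace ℝ (Fin d)) 1) *
        (b ^ (-(s + d) / 2) * (1 / 2) * Real.Gamma ((s + d) / 2)) := by
  have : Nonempty (Fin d) := ⟨⟨0, hd⟩⟩
  rw [integral_fun_norm_addHaar volume (fun y : ℝ => y ^ s * Real.exp (-b * y ^ 2)),
    finrank_euclideanSpace_fin, nsmul_eq_mul, smul_eq_mul, mul_assoc]
  congr 2
  have h := integral_rpow_mul_exp_neg_mul_rpow (p := 2) (q := s + d - 1) two_pos (by linarith) hb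
  rw [show s + d - 1 + 1 = s + d by ring] at h
  rw [← h]
  refine setIntegral_congr_fun measurableSet_Ioi fun y hy => ?_
  have hy : 0 < y := hy
  simp only [smul_eq_mul]
  rw [← mul_assoc, ← Real.rpow_natCast, ← Real.rpow_add hy, Real.rpow_two, Nat.cast_sub hd]
  congr 2
  push_cast
  ring

lemma integral_norm_rpow_mul_exp_neg_mul_sq_norm_pos {d : ℕ} (hd : 0 < d) {s b : ℝ}
    (hs : -(d : ℝ) < s) (hb : 0 < b) :
    0 < ∫ x : EuclideanSpace ℝ (Fin d), ‖x‖ ^ s * Real.exp (-b * ‖x‖ ^ 2) := by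
  rw [integral_norm_rpow_mul_exp_neg_mul_sq_norm hd hs hb]
  have h1 : 0 < volume.real (Metric.ball (0 : EuclideanSpace ℝ (Fin d)) 1) :=
    ENNReal.toReal_pos (Metric.measure_ball_pos _ _ one_pos).ne' measure_ball_lt_top.ne
  have h2 : 0 < Real.Gamma ((s + d) / 2) := Real.Gamma_pos_of_pos (by linarith)
  have h3 : (0 : ℝ) < d := by exact_mod_cast hd
  positivity

lemma integrable_norm_rpow_mul_exp_neg_mul_sq_norm {d : ℕ} (hd : 0 < d) {s b : ℝ}
    (hs : -(d : ℝ) < s) (hb : 0 < b) :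
    Integrable fun x : EuclideanSpace ℝ (Fin d) => ‖x‖ ^ s * Real.exp (-b * ‖x‖ ^ 2) :=
  .of_integral_ne_zero (integral_norm_rpow_mul_exp_neg_mul_sq_norm_pos hd hs hb).ne'

lemma integral_norm_rpow_add_two_mul_exp_neg_mul_sq_norm {d : ℕ} (hd : 0 < d) {s b : ℝ}
    (hs : -(d : ℝ) < s) (hb : 0 < b) :
    ∫ x : EuclideanSpace ℝ (Fin d), ‖x‖ ^ (s + 2) * Real.exp (-b * ‖x‖ ^ 2) =
      (s + d) / (2 * b) *
        ∫ x : EuclideanSpace ℝ (Fin d), ‖x‖ ^ s * Real.exp (-b * ‖x‖ ^ 2) := by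
  rw [integral_norm_rpow_mul_exp_neg_mul_sq_norm hd hs hb,
    integral_norm_rpow_mul_exp_neg_mul_sq_norm hd (by linarith) hb,
    show (s + 2 + d) / 2 = (s + d) / 2 + 1 by ring, Real.Gamma_add_one (by linarith),
    show -(s + 2 + d) / 2 = -(s + d) / 2 - 1 by ring, Real.rpow_sub_one hb.ne']
  field_simp

lemma integral_coord_sq_mul_norm {d : ℕ} (j k : Fin d) (f : ℝ → ℝ) :
    ∫ x : EuclideanSpace ℝ (Fin d), x j ^ 2 * f ‖x‖ =
      ∫ x : EuclideanSpace ℝ (Fin d), x k ^ 2 * f ‖x‖ := by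
  let e := LinearIsometryEquiv.piLpCongrLeft 2 ℝ ℝ (Equiv.swap j k)
  rw [← e.measurePreserving.integral_comp e.toHomeomorph.measurableEmbedding]
  refine integral_congr_ae (Eventually.of_forall fun x => ?_)
  simp [e, LinearIsometryEquiv.piLpCongrLeft_apply, Equiv.piCongrLeft']

lemma integrable_coord_sq_mul_norm_rpow_mul_exp {d : ℕ} (j : Fin d) {s b : ℝ}
    (hs : -(d : ℝ) < s + 2) (hb : 0 < b) :
    Integrable fun x : EuclideanSpace ℝ (Fin d) =>
      x j ^ 2 * (‖x‖ ^ s * Real.exp (-b * ‖x‖ ^ 2)) := by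
  refine (integrable_norm_rpow_mul_exp_neg_mul_sq_norm j.pos hs hb).mono' (by fun_prop)
    (Eventually.of_forall fun x => ?_)
  rw [Real.norm_of_nonneg (by positivity), ← mul_assoc]
  refine mul_le_mul_of_nonneg_right ?_ (Real.exp_nonneg _)
  rcases eq_or_ne x 0 with rfl | hx
  · simp [Real.rpow_nonneg]
  rw [Real.rpow_add (norm_pos_iff.2 hx), Real.rpow_two, mul_comm]
  exact mul_le_mul_of_nonneg_left
    (sq_le_sq.2 ((PiLp.norm_apply_le x j).trans (le_abs_self _))) (by positivity)

lemma integral_coord_sq_mul_norm_rpow_mul_exp {d : ℕ} (j : Fin d) {s b : ℝ}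
    (hs : -(d : ℝ) < s + 2) (hb : 0 < b) :
    ∫ x : EuclideanSpace ℝ (Fin d), x j ^ 2 * (‖x‖ ^ s * Real.exp (-b * ‖x‖ ^ 2)) =
      (d : ℝ)⁻¹ *
        ∫ x : EuclideanSpace ℝ (Fin d), ‖x‖ ^ (s + 2) * Real.exp (-b * ‖x‖ ^ 2) := by
  have hd : (d : ℝ) ≠ 0 := by exact_mod_cast j.pos.ne'
  rw [eq_inv_mul_iff_mul_eq₀ hd]
  have hsum : ∑ k : Fin d,
      ∫ x : EuclideanSpace ℝ (Fin d), x k ^ 2 * (‖x‖ ^ s * Real.exp (-b * ‖x‖ ^ 2)) =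
      d * ∫ x : EuclideanSpace ℝ (Fin d), x j ^ 2 * (‖x‖ ^ s * Real.exp (-b * ‖x‖ ^ 2)) := by
    rw [Finset.sum_congr rfl fun k _ =>
      integral_coord_sq_mul_norm k j fun r => r ^ s * Real.exp (-b * r ^ 2)]
    simp
  rw [← hsum, ← integral_finsetSum _ fun k _ => integrable_coord_sq_mul_norm_rpow_mul_exp k hs hb]
  have : Nonempty (Fin d) := ⟨j⟩
  refine integral_congr_ae ?_
  filter_upwards [Measure.ae_ne volume (0 : EuclideanSpace ℝ (Fin d))] with x hx
  rw [← Finset.sum_mul, ← EuclideanSpace.real_norm_sq_eq, ← mul_assoc,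
    Real.rpow_add (norm_pos_iff.2 hx), Real.rpow_two, mul_comm (‖x‖ ^ s)]

lemma norm_cexp_I_mul_ofReal (r : ℝ) : ‖Complex.exp (Complex.I * r)‖ = 1 := by
  rw [mul_comm, Complex.norm_exp_ofReal_mul_I]

lemma integral_gaussian_mul_cexp_inner {d : ℕ} {b : ℝ} (hb : 0 < b)
    (y : EuclideanSpace ℝ (Fin d)) :
    ∫ ξ : EuclideanSpace ℝ (Fin d),
        ((Real.exp (-b * ‖ξ‖ ^ 2) : ℝ) : ℂ) * Complex.exp (Complex.I * (⟪y, ξ⟫ : ℝ)) =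
      (((Real.pi / b) ^ ((d : ℝ) / 2) * Real.exp (-‖y‖ ^ 2 / (4 * b)) : ℝ) : ℂ) := by
  have h := GaussianFourier.integral_cexp_neg_mul_sq_norm_add (b := (b : ℂ)) (by simpa using hb)
    Complex.I y
  rw [finrank_euclideanSpace_fin] at h
  push_cast
  rw [Complex.ofReal_cpow (by positivity)]
  push_cast
  simp only [← Complex.exp_add]
  rw [h, Complex.I_sq]
  congr 2
  ring

lemma coord_sq_mul_gaussian_eq_integral {d : ℕ} (j : Fin d) {b : ℝ} (hb : 0 < b)
    (y : EuclideanSpace ℝ (Fin d)) :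
    (((y j) ^ 2 * ((Real.pi / b) ^ ((d : ℝ) / 2) * Real.exp (-‖y‖ ^ 2 / (4 * b))) : ℝ) : ℂ) =
      ∫ ξ : EuclideanSpace ℝ (Fin d),
        (((2 * b - 4 * b ^ 2 * ξ j ^ 2) * Real.exp (-b * ‖ξ‖ ^ 2) : ℝ) : ℂ) *
          Complex.exp (Complex.I * (⟪y, ξ⟫ : ℝ)) := by
  let v : EuclideanSpace ℝ (Fin d) := EuclideanSpace.single j 1
  let e : EuclideanSpace ℝ (Fin d) → ℂ := fun ξ => Complex.exp (Complex.I * (⟪y, ξ⟫ : ℝ))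
  let f : EuclideanSpace ℝ (Fin d) → ℝ := fun ξ => Real.exp (-b * ‖ξ‖ ^ 2)
  have hγ : Integrable f := by
    simpa [f] using integrable_norm_rpow_mul_exp_neg_mul_sq_norm (s := 0) j.pos
      (by simpa using j.pos) hb
  have hγ2 : Integrable fun ξ => ξ j ^ 2 * f ξ := by
    simpa [f] using integrable_coord_sq_mul_norm_rpow_mul_exp (s := 0) j
      (by linarith [d.cast_nonneg (α := ℝ)]) hb
  have hγ1 : Integrable fun ξ => ξ j * f ξ := by
    refine (hγ.add hγ2).mono' (by fun_prop) (Eventually.of_forall fun ξ => ?_)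
    have : 0 < f ξ := Real.exp_pos _
    rw [norm_mul, Real.norm_of_nonneg this.le, Real.norm_eq_abs, Pi.add_apply, ← sq_abs (ξ j)]
    nlinarith [sq_nonneg (|ξ j| - 1 / 2)]
  have hint : ∀ (g : EuclideanSpace ℝ (Fin d) → ℝ) (c : ℂ), Integrable g →
      Integrable fun ξ => (g ξ : ℂ) * (c * e ξ) := by
    intro g c hg
    have : (fun ξ => (g ξ : ℂ) * (c * e ξ)) = fun ξ => c * ((g ξ : ℂ) * e ξ) := by
      ext; ring
    rw [this]
    refine Integrable.const_mul ?_ _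
    refine hg.ofReal.mul_bdd (c := 1) (by fun_prop) (Eventually.of_forall fun ξ => ?_)
    exact (norm_cexp_I_mul_ofReal _).le
  have hint' : ∀ (g : EuclideanSpace ℝ (Fin d) → ℝ), Integrable g →
      Integrable fun ξ => (g ξ : ℂ) * e ξ := by
    intro g hg
    simpa using hint g 1 hg
  have hline : ∀ ξ, HasDerivAt (fun t : ℝ => ‖ξ + t • v‖ ^ 2) (2 * ξ j) 0 := by
    intro ξ
    have : (fun t : ℝ => ‖ξ + t • v‖ ^ 2) = fun t => ‖ξ‖ ^ 2 + 2 * ξ j * t + t ^ 2 := by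
      ext t
      rw [norm_add_sq_real, inner_smul_right, norm_smul]
      simp [v, EuclideanSpace.inner_single_right]
      ring
    rw [this]
    exact ((((hasDerivAt_id (0 : ℝ)).const_mul (2 * ξ j)).const_add (‖ξ‖ ^ 2)).add
      ((hasDerivAt_id (0 : ℝ)).pow 2)).congr_deriv (by simp)
  have hf : ∀ ξ, HasLineDerivAt ℝ f (-(2 * b) * (ξ j * f ξ)) ξ v := by
    intro ξ
    refine ((hline ξ).const_mul (-b)).exp.congr_deriv ?_
    rw [zero_smul, add_zero]
    ring
  have hf1 : ∀ ξ, HasLineDerivAt ℝ (fun ξ => ξ j * f ξ) ((1 - 2 * b * ξ j ^ 2) * f ξ) ξ v := by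
    intro ξ
    have h1 : HasLineDerivAt ℝ (fun ξ : EuclideanSpace ℝ (Fin d) => ξ j) 1 ξ v := by
      have := ((hasDerivAt_id (0 : ℝ)).const_add (ξ j))
      unfold HasLineDerivAt
      simpa [v] using this
    refine (HasDerivAt.mul h1 (hf ξ)).congr_deriv ?_
    rw [zero_smul, add_zero]
    ring
  have he : ∀ ξ, HasLineDerivAt ℝ e (Complex.I * y j * e ξ) ξ v := by
    intro ξ
    have h1 : HasDerivAt (fun t : ℝ => Complex.I * ((⟪y, ξ + t • v⟫ : ℝ) : ℂ))
        (Complex.I * y j) 0 := by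
      have := ((((hasDerivAt_id (0 : ℝ)).mul_const (y j)).const_add ⟪y, ξ⟫).ofReal_comp).const_mul
        Complex.I
      simpa [v, inner_add_right, inner_smul_right, EuclideanSpace.inner_single_right] using this
    refine h1.cexp.congr_deriv ?_
    rw [zero_smul, add_zero, mul_comm]
  have hofReal : ∀ {g : EuclideanSpace ℝ (Fin d) → ℝ} {g' : ℝ} {ξ}, HasLineDerivAt ℝ g g' ξ v →
      HasLineDerivAt ℝ (fun ξ => (g ξ : ℂ)) (g' : ℂ) ξ v :=
    fun h => HasDerivAt.ofReal_comp h
  have h1 : Integrable fun ξ => -(2 * b) * (ξ j * f ξ) := hγ1.const_mul _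
  have h2 : Integrable fun ξ => (1 - 2 * b * ξ j ^ 2) * f ξ := by
    have := hγ.sub (hγ2.const_mul (2 * b))
    refine this.congr (Eventually.of_forall fun ξ => ?_)
    simp only [Pi.sub_apply]
    ring
  have ibp1 := integral_bilinear_hasLineDerivAt_right_eq_neg_left_of_integrable (μ := volume)
    (B := ContinuousLinearMap.mul ℝ ℂ) (v := v) (hint' _ h1) (hint f (Complex.I * y j) hγ)
    (hint' _ hγ) (fun ξ _ => hofReal (hf ξ)) (fun ξ _ => he ξ)
  have ibp2 := integral_bilinear_hasLineDerivAt_right_eq_neg_left_of_integrable (μ := volume)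
    (B := ContinuousLinearMap.mul ℝ ℂ) (v := v) (hint' _ h2) (hint _ (Complex.I * y j) hγ1)
    (hint' _ hγ1) (fun ξ _ => hofReal (hf1 ξ)) (fun ξ _ => he ξ)
  simp only [ContinuousLinearMap.mul_apply', Complex.ofReal_mul (-(2 * b))] at ibp1 ibp2
  have key := integral_gaussian_mul_cexp_inner hb y
  change ∫ ξ, (f ξ : ℂ) * e ξ = _ at key
  have pull : ∀ (g : EuclideanSpace ℝ (Fin d) → ℝ) (c : ℂ),
      ∫ ξ, (g ξ : ℂ) * (c * e ξ) = c * ∫ ξ, (g ξ : ℂ) * e ξ := by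
    intro g c
    rw [← integral_const_mul]
    congr with ξ
    ring
  have pull' : ∀ (g : EuclideanSpace ℝ (Fin d) → ℝ) (c : ℂ),
      ∫ ξ, c * (g ξ : ℂ) * e ξ = c * ∫ ξ, (g ξ : ℂ) * e ξ := by
    intro g c
    rw [← integral_const_mul]
    congr with ξ
    ring
  rw [pull, pull', key] at ibp1
  rw [pull] at ibp2
  have hrhs : ∫ ξ : EuclideanSpace ℝ (Fin d),
        (((2 * b - 4 * b ^ 2 * ξ j ^ 2) * Real.exp (-b * ‖ξ‖ ^ 2) : ℝ) : ℂ) *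
          Complex.exp (Complex.I * (⟪y, ξ⟫ : ℝ)) =
      (2 * b : ℂ) * ∫ ξ, (((1 - 2 * b * ξ j ^ 2) * f ξ : ℝ) : ℂ) * e ξ := by
    rw [← integral_const_mul]
    congr with ξ
    simp only [f, e]
    push_cast
    ring
  rw [hrhs, Complex.ofReal_mul]
  set A := ∫ ξ, (((ξ j * f ξ : ℝ)) : ℂ) * e ξ
  set B := ∫ ξ, (((1 - 2 * b * ξ j ^ 2) * f ξ : ℝ) : ℂ) * e ξ
  set K := (Real.pi / b) ^ ((d : ℝ) / 2) * Real.exp (-‖y‖ ^ 2 / (4 * b))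
  push_cast at ibp1 ⊢
  linear_combination (-(Complex.I * y j)) * ibp1 - (2 * b : ℂ) * ibp2 +
    (y j : ℂ) ^ 2 * K * Complex.I_sq

lemma integral_hessian_gaussian_mul_norm_rpow {d : ℕ} (j : Fin d) {α b : ℝ}
    (hα : 2 < α + d) (hb : 0 < b) :
    ∫ ξ : EuclideanSpace ℝ (Fin d),
        (2 * b - 4 * b ^ 2 * ξ j ^ 2) * Real.exp (-b * ‖ξ‖ ^ 2) * (-(‖ξ‖ ^ α / 2)) =
      α / 2 * ∫ ξ : EuclideanSpace ℝ (Fin d), Real.exp (-b * ‖ξ‖ ^ 2) *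
        (‖ξ‖ ^ (α - 2) + (ξ j) ^ 2 * (α - 2) * ‖ξ‖ ^ (α - 4)) := by
  have hd : (0 : ℝ) < d := by exact_mod_cast j.pos
  have hl : ∫ ξ : EuclideanSpace ℝ (Fin d),
        (2 * b - 4 * b ^ 2 * ξ j ^ 2) * Real.exp (-b * ‖ξ‖ ^ 2) * (-(‖ξ‖ ^ α / 2)) =
      ∫ ξ : EuclideanSpace ℝ (Fin d), ((-b) * (‖ξ‖ ^ α * Real.exp (-b * ‖ξ‖ ^ 2)) +
        2 * b ^ 2 * (ξ j ^ 2 * (‖ξ‖ ^ α * Real.exp (-b * ‖ξ‖ ^ 2)))) := by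
    congr with ξ
    ring
  have hr : ∫ ξ : EuclideanSpace ℝ (Fin d), Real.exp (-b * ‖ξ‖ ^ 2) *
        (‖ξ‖ ^ (α - 2) + (ξ j) ^ 2 * (α - 2) * ‖ξ‖ ^ (α - 4)) =
      ∫ ξ : EuclideanSpace ℝ (Fin d), (‖ξ‖ ^ (α - 2) * Real.exp (-b * ‖ξ‖ ^ 2) +
        (α - 2) * (ξ j ^ 2 * (‖ξ‖ ^ (α - 4) * Real.exp (-b * ‖ξ‖ ^ 2)))) := by
    congr with ξ
    ring
  rw [hl, hr,
    integral_add ((integrable_norm_rpow_mul_exp_neg_mul_sq_norm j.pos (by linarith) hb).const_mul _)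
      ((integrable_coord_sq_mul_norm_rpow_mul_exp j (by linarith) hb).const_mul _),
    integral_add (integrable_norm_rpow_mul_exp_neg_mul_sq_norm j.pos (by linarith) hb)
      ((integrable_coord_sq_mul_norm_rpow_mul_exp j (by linarith) hb).const_mul _)]
  simp only [integral_const_mul]
  rw [integral_coord_sq_mul_norm_rpow_mul_exp j (by linarith) hb,
    integral_coord_sq_mul_norm_rpow_mul_exp j (by linarith) hb,
    integral_norm_rpow_add_two_mul_exp_neg_mul_sq_norm j.pos (by linarith) hb,
    show α - 4 + 2 = α - 2 by ring]
  have h := integral_norm_rpow_add_two_mul_exp_neg_mul_sq_norm (s := α - 2) j.pos (by linarith) hb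
  rw [show α - 2 + 2 = α by ring] at h
  rw [h]
  field_simp
  ring

lemma integrable_hessian_gaussian {d : ℕ} (j : Fin d) {b : ℝ} (hb : 0 < b) :
    Integrable fun ξ : EuclideanSpace ℝ (Fin d) =>
      (2 * b - 4 * b ^ 2 * ξ j ^ 2) * Real.exp (-b * ‖ξ‖ ^ 2) := by
  have hd : (0 : ℝ) < d := by exact_mod_cast j.pos
  have h0 := (integrable_norm_rpow_mul_exp_neg_mul_sq_norm (d := d) (s := 0) j.pos
    (by linarith) hb).const_mul (2 * b)
  have h1 := (integrable_coord_sq_mul_norm_rpow_mul_exp (s := 0) j (by linarith) hb).const_mul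
    (4 * b ^ 2)
  refine (h0.sub h1).congr (Eventually.of_forall fun ξ => ?_)
  simp only [Pi.sub_apply, Real.rpow_zero]
  ring

lemma integral_integral_mul_cexp_inner_eq_integral_mul_charFn {d : ℕ}
    (μ : Measure (EuclideanSpace ℝ (Fin d))) [IsProbabilityMeasure μ]
    {h : EuclideanSpace ℝ (Fin d) → ℝ} (hh : Integrable h) (c : ℝ) :
    ∫ x, (∫ ξ, (h ξ : ℂ) * Complex.exp (Complex.I * (⟪c • x, ξ⟫ : ℝ))) ∂μ =
      ∫ ξ, (h ξ : ℂ) * charFn μ (c • ξ) := by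
  rw [integral_integral_swap]
  · congr with ξ
    rw [integral_const_mul, charFn]
    simp only [inner_smul_left, real_inner_comm]
  · have h1 : Integrable (fun p : EuclideanSpace ℝ (Fin d) × EuclideanSpace ℝ (Fin d) =>
        (h p.2 : ℂ)) (μ.prod volume) :=
      Integrable.comp_snd (f := fun ξ => (h ξ : ℂ)) hh.ofReal μ
    refine h1.mul_bdd (c := 1) (by fun_prop) (Eventually.of_forall fun p => ?_)
    exact (norm_cexp_I_mul_ofReal _).le

lemma tendsto_rpow_mul_exp_sub_one {α : ℝ} (hα : 0 < α) (u : ℝ) :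
    Tendsto (fun R : ℝ => R ^ α * (Real.exp (-(R ^ α)⁻¹ * u) - 1)) atTop (𝓝 (-u)) := by
  have hd : HasDerivAt (fun t : ℝ => Real.exp (-t * u)) (-u) 0 :=
    ((hasDerivAt_id (0 : ℝ)).neg.mul_const u).exp.congr_deriv (by simp)
  have ht : Tendsto (fun R : ℝ => (R ^ α)⁻¹) atTop (𝓝[≠] 0) :=
    (tendsto_inv_atTop_nhdsGT_zero.comp (tendsto_rpow_atTop hα)).mono_right
      (nhdsWithin_mono _ fun _ h => ne_of_gt h)
  have := hd.tendsto_slope_zero.comp ht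
  simpa [Function.comp_def] using this

lemma tendsto_rpow_mul_integral_mul_exp_norm_rpow {d : ℕ} {α : ℝ} (hα : 0 < α)
    {h : EuclideanSpace ℝ (Fin d) → ℝ} (hh : Integrable h) (h0 : ∫ ξ, h ξ = 0)
    (hhα : Integrable fun ξ => h ξ * (-(‖ξ‖ ^ α / 2))) :
    Tendsto (fun R : ℝ => R ^ α * ∫ ξ, h ξ * Real.exp (-(‖R⁻¹ • ξ‖ ^ α / 2))) atTop
      (𝓝 (∫ ξ, h ξ * (-(‖ξ‖ ^ α / 2)))) := by
  have key : Tendsto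
      (fun R : ℝ => ∫ ξ, h ξ * (R ^ α * (Real.exp (-(R ^ α)⁻¹ * (‖ξ‖ ^ α / 2)) - 1))) atTop
      (𝓝 (∫ ξ, h ξ * (-(‖ξ‖ ^ α / 2)))) := by
    refine tendsto_integral_filter_of_dominated_convergence (fun ξ => ‖h ξ * (-(‖ξ‖ ^ α / 2))‖)
      (Eventually.of_forall fun R => hh.aestronglyMeasurable.mul
        (by fun_prop (disch := positivity))) ?_ hhα.norm
      (Eventually.of_forall fun ξ => (tendsto_rpow_mul_exp_sub_one hα _).const_mul _)
    filter_upwards [eventually_gt_atTop 0] with R hR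
    refine Eventually.of_forall fun ξ => ?_
    rw [norm_mul (h ξ), norm_mul (h ξ), norm_neg]
    gcongr
    have hRα : 0 < R ^ α := Real.rpow_pos_of_pos hR α
    have hu : 0 ≤ ‖ξ‖ ^ α / 2 := by positivity
    have h1 := Real.add_one_le_exp (-(R ^ α)⁻¹ * (‖ξ‖ ^ α / 2))
    have h2 : Real.exp (-(R ^ α)⁻¹ * (‖ξ‖ ^ α / 2)) ≤ 1 :=
      Real.exp_le_one_iff.2 (by have := inv_pos.2 hRα; nlinarith)
    rw [Real.norm_of_nonneg hu, norm_mul, Real.norm_of_nonneg hRα.le,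
      Real.norm_of_nonpos (by linarith)]
    calc R ^ α * -(Real.exp (-(R ^ α)⁻¹ * (‖ξ‖ ^ α / 2)) - 1)
        ≤ R ^ α * ((R ^ α)⁻¹ * (‖ξ‖ ^ α / 2)) := by gcongr; linarith
      _ = ‖ξ‖ ^ α / 2 := by field_simp
  refine key.congr' ?_
  filter_upwards [eventually_gt_atTop 0] with R hR
  have hscale : ∀ ξ : EuclideanSpace ℝ (Fin d),
      -(R ^ α)⁻¹ * (‖ξ‖ ^ α / 2) = -(‖R⁻¹ • ξ‖ ^ α / 2) := by
    intro ξ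
    rw [norm_smul, Real.norm_of_nonneg (by positivity),
      Real.mul_rpow (by positivity) (norm_nonneg _), Real.inv_rpow hR.le]
    ring
  simp only [hscale]
  have hint : Integrable fun ξ => h ξ * Real.exp (-(‖R⁻¹ • ξ‖ ^ α / 2)) := by
    refine hh.mul_bdd (c := 1) (by fun_prop (disch := positivity)) (Eventually.of_forall fun ξ => ?_)
    rw [Real.norm_of_nonneg (Real.exp_nonneg _)]
    exact Real.exp_le_one_iff.2 (neg_nonpos.2 (by positivity))
  calc ∫ ξ, h ξ * (R ^ α * (Real.exp (-(‖R⁻¹ • ξ‖ ^ α / 2)) - 1))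
      = ∫ ξ, R ^ α * (h ξ * Real.exp (-(‖R⁻¹ • ξ‖ ^ α / 2)) - h ξ) := by
        congr with ξ
        ring
    _ = R ^ α * ∫ ξ, h ξ * Real.exp (-(‖R⁻¹ • ξ‖ ^ α / 2)) := by
        rw [integral_const_mul, integral_sub hint hh, h0, sub_zero]

lemma FT_sq_exp_neg_sq_norm {d : ℕ} (ξ : EuclideanSpace ℝ (Fin d)) :
    FT (fun y => Real.exp (-‖y‖ ^ 2) ^ 2) ξ =
      (((Real.pi / 2) ^ ((d : ℝ) / 2) * Real.exp (-(1 / 8) * ‖ξ‖ ^ 2) : ℝ) : ℂ) := by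
  have h := integral_gaussian_mul_cexp_inner two_pos (-ξ)
  rw [norm_neg, show -‖ξ‖ ^ 2 / (4 * 2) = -(1 / 8) * ‖ξ‖ ^ 2 by ring] at h
  rw [← h, FT]
  congr with y
  rw [← Real.exp_nat_mul, inner_neg_left]
  push_cast
  ring_nf

/-- Asymptotics of `E[g_{R,j}(X_α)²]/R^{2−α}` as `R → ∞`, where
`g_{R,j}(x) = x_j exp(−‖x/R‖²)` and `X_α` is rotationally invariant `α`-stable
(`lem:rate1`). -/
theorem stmt10 (d : ℕ) (hd : 0 < d) (α : ℝ) (hα : α ∈ Ioo (1 : ℝ) 2)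
    (μα : Measure (EuclideanSpace ℝ (Fin d))) [IsProbabilityMeasure μα]
    (hchar : ∀ ξ, charFn μα ξ = Complex.exp (-((‖ξ‖ ^ α / 2 : ℝ) : ℂ))) :
    ∀ j : Fin d,
      Tendsto
        (fun R : ℝ =>
          (((∫ x, (x j * Real.exp (-‖R⁻¹ • x‖ ^ 2)) ^ 2 ∂μα) / R ^ (2 - α) : ℝ) : ℂ))
        atTop
        (𝓝 (((α / 2 : ℝ) : ℂ) * (((2 * Real.pi) ^ d : ℝ) : ℂ)⁻¹ *
          ∫ ξ, FT (fun y => Real.exp (-‖y‖ ^ 2) ^ 2) ξ *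
            ((‖ξ‖ ^ (α - 2) + (ξ j) ^ 2 * (α - 2) * ‖ξ‖ ^ (α - 4) : ℝ) : ℂ))) := by
  intro j
  have hd' : (1 : ℝ) ≤ d := by exact_mod_cast hd
  obtain ⟨hα1, hα2⟩ := hα
  let h : EuclideanSpace ℝ (Fin d) → ℝ := fun ξ =>
    (2 * (1 / 8) - 4 * (1 / 8) ^ 2 * ξ j ^ 2) * Real.exp (-(1 / 8) * ‖ξ‖ ^ 2)
  have hb : (0 : ℝ) < 1 / 8 := by norm_num
  let C : ℝ := (Real.pi / (1 / 8)) ^ ((d : ℝ) / 2)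
  have hC : 0 < C := Real.rpow_pos_of_pos (by positivity) _
  have hh : Integrable h := integrable_hessian_gaussian j hb
  have hrep : ∀ y : EuclideanSpace ℝ (Fin d),
      (((y j) ^ 2 * (C * Real.exp (-‖y‖ ^ 2) ^ 2) : ℝ) : ℂ) =
        ∫ ξ, (h ξ : ℂ) * Complex.exp (Complex.I * (⟪y, ξ⟫ : ℝ)) := by
    intro y
    rw [← coord_sq_mul_gaussian_eq_integral j hb y, ← Real.exp_nat_mul,
      show -‖y‖ ^ 2 / (4 * (1 / 8)) = ((2 : ℕ) : ℝ) * -‖y‖ ^ 2 by push_cast; ring]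
  have h0 : ∫ ξ, h ξ = 0 := by
    have := hrep 0
    simp only [inner_zero_left, Complex.ofReal_zero, mul_zero, Complex.exp_zero, mul_one,
      integral_complex_ofReal, PiLp.zero_apply] at this
    simpa using this.symm
  have hhα : Integrable fun ξ => h ξ * (-(‖ξ‖ ^ α / 2)) := by
    have h1 := (integrable_norm_rpow_mul_exp_neg_mul_sq_norm (d := d) (s := α) hd
      (by linarith) hb).const_mul (-(1 / 8))
    have h2 := (integrable_coord_sq_mul_norm_rpow_mul_exp (s := α) j (by linarith) hb).const_mul
      (1 / 32)
    refine (h1.add h2).congr (Eventually.of_forall fun ξ => ?_)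
    simp only [Pi.add_apply, h]
    ring
  have hexp : ∀ R : ℝ, 0 < R →
      (∫ x, (x j * Real.exp (-‖R⁻¹ • x‖ ^ 2)) ^ 2 ∂μα) / R ^ (2 - α) =
        C⁻¹ * (R ^ α * ∫ ξ, h ξ * Real.exp (-(‖R⁻¹ • ξ‖ ^ α / 2))) := by
    intro R hR
    have hs := integral_integral_mul_cexp_inner_eq_integral_mul_charFn μα hh R⁻¹
    simp only [← hrep, hchar, ← Complex.ofReal_neg, ← Complex.ofReal_exp, ← Complex.ofReal_mul,
      integral_complex_ofReal, Complex.ofReal_inj] at hs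
    rw [← hs, ← integral_const_mul, ← integral_const_mul, ← integral_div]
    congr with x
    rw [Real.rpow_sub hR, Real.rpow_two]
    have : 0 < R ^ α := Real.rpow_pos_of_pos hR α
    simp only [PiLp.smul_apply, smul_eq_mul]
    field_simp
  have hlim := ((tendsto_rpow_mul_integral_mul_exp_norm_rpow (by linarith) hh h0 hhα).const_mul
    C⁻¹).ofReal
  have hconst : C⁻¹ = ((2 * Real.pi) ^ d)⁻¹ * (Real.pi / 2) ^ ((d : ℝ) / 2) := by
    have h1 : (2 * Real.pi) ^ d = C * (Real.pi / 2) ^ ((d : ℝ) / 2) := by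
      rw [← Real.mul_rpow (by positivity) (by positivity),
        show Real.pi / (1 / 8) * (Real.pi / 2) = (2 * Real.pi) ^ (2 : ℝ) by
          rw [Real.rpow_two]; ring,
        ← Real.rpow_mul (by positivity), ← Real.rpow_natCast]
      congr 1
      ring
    have h2 : 0 < (Real.pi / 2) ^ ((d : ℝ) / 2) := Real.rpow_pos_of_pos (by positivity) _
    rw [h1]
    field_simp
  have hval : (((α / 2 : ℝ) : ℂ) * (((2 * Real.pi) ^ d : ℝ) : ℂ)⁻¹ *
          ∫ ξ, FT (fun y => Real.exp (-‖y‖ ^ 2) ^ 2) ξ *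
            ((‖ξ‖ ^ (α - 2) + (ξ j) ^ 2 * (α - 2) * ‖ξ‖ ^ (α - 4) : ℝ) : ℂ)) =
      ((C⁻¹ * ∫ ξ, h ξ * (-(‖ξ‖ ^ α / 2)) : ℝ) : ℂ) := by
    rw [integral_hessian_gaussian_mul_norm_rpow j (by linarith) hb, hconst]
    simp only [FT_sq_exp_neg_sq_norm, ← Complex.ofReal_mul, ← Complex.ofReal_inv,
      integral_complex_ofReal, Complex.ofReal_inj, mul_assoc, integral_const_mul]
    ring
  rw [hval]
  refine hlim.congr' ?_
  filter_upwards [eventually_gt_atTop 0] with R hR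
  rw [hexp R hR]
end
end
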